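/- The deconcatenation coproduct δ : Q → Q ⊗[k] Q, defined on basis elements by δ((I₁, …, I_k)) = Σ_{j=0}^{k} (I₁, …, I_j) ⊗ (I_{j+1}, …, I_k), is multiplicative with respect to the quasi-shuffle product: for all u, v ∈ Q one has δ(u ⧢ v) = δ(u) · δ(v), where Q ⊗[k] Q carries the componentwise quasi-shuffle product (a ⊗ b)·(c ⊗ d) = (a ⧢ c) ⊗ (b ⧢ d). (This is the bialgebra compatibility making QSym_n a Hopf algebra.) -/

import Mathlib

open scoped TensorProduct

noncomputable section

/-- Nonempty words over `Fin n`. -/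
abbrev CWord (n : ℕ) : Type := {l : List (Fin n) // l ≠ []}

/-- Multisequences: finite lists of nonempty words over `Fin n`. -/
abbrev Multiseq (n : ℕ) : Type := List (CWord n)

/-- `QSym_n` in its monomial basis: the free `k`-module on multisequences. -/
abbrev QSymC (k : Type*) [Field k] (n : ℕ) : Type _ := Multiseq n →₀ k

/-- Concatenation of two nonempty words. -/
def wordConcat {n : ℕ} (I J : CWord n) : CWord n := ⟨I.1 ++ J.1, by simp [I.2]⟩

/-- The quasi-shuffle product of two basis multisequences. -/
def qsBasis (k : Type*) [Field k] (n : ℕ) : Multiseq n → Multiseq n → QSymC k n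
  | [], J => Finsupp.single J 1
  | I :: Is, [] => Finsupp.single (I :: Is) 1
  | I :: Is, J :: Js =>
      Finsupp.mapDomain (fun L => I :: L) (qsBasis k n Is (J :: Js)) +
      Finsupp.mapDomain (fun L => J :: L) (qsBasis k n (I :: Is) Js) +
      Finsupp.mapDomain (fun L => wordConcat I J :: L) (qsBasis k n Is Js)
  termination_by I J => I.length + J.length

/-- The quasi-shuffle product on `QSym_n`, the bilinear extension of `qsBasis`. -/
def qmulL (k : Type*) [Field k] (n : ℕ) :
    QSymC k n →ₗ[k] QSymC k n →ₗ[k] QSymC k n :=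
  Finsupp.lift (QSymC k n →ₗ[k] QSymC k n) k (Multiseq n) fun I =>
    Finsupp.lift (QSymC k n) k (Multiseq n) fun J => qsBasis k n I J

/-- The deconcatenation coproduct on `QSym_n`. -/
def qdelta (k : Type*) [Field k] (n : ℕ) :
    QSymC k n →ₗ[k] QSymC k n ⊗[k] QSymC k n :=
  Finsupp.lift (QSymC k n ⊗[k] QSymC k n) k (Multiseq n) fun I =>
    ∑ j ∈ Finset.range (I.length + 1),
      Finsupp.single (I.take j) (1 : k) ⊗ₜ[k] Finsupp.single (I.drop j) (1 : k)

/-- The componentwise quasi-shuffle product on `QSym_n ⊗ QSym_n`: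
`(a ⊗ b) · (c ⊗ d) = (a ⧢ c) ⊗ (b ⧢ d)`. -/
def qmul2 (k : Type*) [Field k] (n : ℕ)
    (x y : QSymC k n ⊗[k] QSymC k n) : QSymC k n ⊗[k] QSymC k n :=
  (TensorProduct.map (TensorProduct.lift (qmulL k n)) (TensorProduct.lift (qmulL k n)))
    ((TensorProduct.tensorTensorTensorComm k (QSymC k n) (QSymC k n) (QSymC k n) (QSymC k n))
      (x ⊗ₜ[k] y))

/-- Prepending the block `I` to every multisequence, as a linear map. -/
def prependL (k : Type*) [Field k] {n : ℕ} (I : CWord n) : QSymC k n →ₗ[k] QSymC k n :=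
  Finsupp.lmapDomain k k (fun L => I :: L)

/-- Prepending the block `I` in the left tensor factor. -/
def prependLeft (k : Type*) [Field k] {n : ℕ} (I : CWord n) :
    QSymC k n ⊗[k] QSymC k n →ₗ[k] QSymC k n ⊗[k] QSymC k n :=
  TensorProduct.map (prependL k I) LinearMap.id

section QuasiShuffle

variable {k : Type*} [Field k] {n : ℕ}

@[simp]
lemma prependL_single (I : CWord n) (L : Multiseq n) (c : k) :
    prependL k I (Finsupp.single L c) = Finsupp.single (I :: L) c := by
  simp [prependL]

@[simp]
lemma prependLeft_tmul (I : CWord n) (a b : QSymC k n) :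
    prependLeft k I (a ⊗ₜ[k] b) = prependL k I a ⊗ₜ[k] b := by
  simp [prependLeft]

lemma qmulL_single_single (I J : Multiseq n) :
    qmulL k n (Finsupp.single I 1) (Finsupp.single J 1) = qsBasis k n I J := by
  simp [qmulL]

lemma qmulL_one_left (x : QSymC k n) : qmulL k n (Finsupp.single [] 1) x = x := by
  suffices h : qmulL k n (Finsupp.single [] 1) = LinearMap.id by rw [h, LinearMap.id_apply]
  ext1 J
  ext1
  simp [qmulL_single_single, qsBasis]

lemma qsBasis_nil_right (I : Multiseq n) : qsBasis k n I [] = Finsupp.single I 1 := by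
  cases I <;> simp [qsBasis]

lemma qmulL_one_right (x : QSymC k n) : qmulL k n x (Finsupp.single [] 1) = x := by
  suffices h : (qmulL k n).flip (Finsupp.single [] 1) = LinearMap.id by
    rw [← LinearMap.flip_apply, h, LinearMap.id_apply]
  ext1 J
  ext1
  simp [qmulL_single_single, qsBasis_nil_right]

/-- The quasi-shuffle recursion, extended bilinearly. -/
lemma qmulL_prependL_prependL (I J : CWord n) (x y : QSymC k n) :
    qmulL k n (prependL k I x) (prependL k J y) =
      prependL k I (qmulL k n x (prependL k J y)) +
      prependL k J (qmulL k n (prependL k I x) y) +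
      prependL k (wordConcat I J) (qmulL k n x y) := by
  suffices h : (qmulL k n).compl₁₂ (prependL k I) (prependL k J) =
      ((qmulL k n).compl₂ (prependL k J)).compr₂ (prependL k I) +
      ((qmulL k n).comp (prependL k I)).compr₂ (prependL k J) +
      (qmulL k n).compr₂ (prependL k (wordConcat I J)) from
    LinearMap.congr_fun₂ h x y
  ext1 Is
  ext1
  ext1 Js
  ext1
  simp [qmulL_single_single, qsBasis, prependL]

@[simp]
lemma qmul2_tmul (a b c d : QSymC k n) :
    qmul2 k n (a ⊗ₜ[k] b) (c ⊗ₜ[k] d) = qmulL k n a c ⊗ₜ[k] qmulL k n b d := by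
  simp [qmul2]

lemma qmul2_add_left (x y z : QSymC k n ⊗[k] QSymC k n) :
    qmul2 k n (x + y) z = qmul2 k n x z + qmul2 k n y z := by
  simp [qmul2, TensorProduct.add_tmul]

lemma qmul2_add_right (x y z : QSymC k n ⊗[k] QSymC k n) :
    qmul2 k n x (y + z) = qmul2 k n x y + qmul2 k n x z := by
  simp [qmul2, TensorProduct.tmul_add]

@[simp]
lemma qmul2_zero_left (x : QSymC k n ⊗[k] QSymC k n) : qmul2 k n 0 x = 0 := by
  simp [qmul2]

@[simp]
lemma qmul2_zero_right (x : QSymC k n ⊗[k] QSymC k n) : qmul2 k n x 0 = 0 := by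
  simp [qmul2]

lemma qmul2_smul_left (c : k) (x y : QSymC k n ⊗[k] QSymC k n) :
    qmul2 k n (c • x) y = c • qmul2 k n x y := by
  rw [qmul2, ← TensorProduct.smul_tmul', map_smul, map_smul, qmul2]

lemma qmul2_smul_right (c : k) (x y : QSymC k n ⊗[k] QSymC k n) :
    qmul2 k n x (c • y) = c • qmul2 k n x y := by
  simp [qmul2]

lemma qmul2_one_left (x : QSymC k n ⊗[k] QSymC k n) :
    qmul2 k n (Finsupp.single [] 1 ⊗ₜ[k] Finsupp.single [] 1) x = x := by
  induction x with
  | zero => simp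
  | tmul a b => simp [qmulL_one_left]
  | add x y hx hy => rw [qmul2_add_right, hx, hy]

lemma qmul2_one_right (x : QSymC k n ⊗[k] QSymC k n) :
    qmul2 k n x (Finsupp.single [] 1 ⊗ₜ[k] Finsupp.single [] 1) = x := by
  induction x with
  | zero => simp
  | tmul a b => simp [qmulL_one_right]
  | add x y hx hy => rw [qmul2_add_left, hx, hy]

lemma qmul2_prependLeft_one_tmul (I : CWord n) (x : QSymC k n ⊗[k] QSymC k n) (b : QSymC k n) :
    qmul2 k n (prependLeft k I x) (Finsupp.single [] 1 ⊗ₜ[k] b) =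
      prependLeft k I (qmul2 k n x (Finsupp.single [] 1 ⊗ₜ[k] b)) := by
  induction x with
  | zero => simp
  | tmul a c => simp [qmulL_one_right]
  | add x y hx hy => simp only [map_add, qmul2_add_left, hx, hy]

lemma qmul2_one_tmul_prependLeft (J : CWord n) (b : QSymC k n) (y : QSymC k n ⊗[k] QSymC k n) :
    qmul2 k n (Finsupp.single [] 1 ⊗ₜ[k] b) (prependLeft k J y) =
      prependLeft k J (qmul2 k n (Finsupp.single [] 1 ⊗ₜ[k] b) y) := by
  induction y with
  | zero => simp
  | tmul a c => simp [qmulL_one_left]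
  | add x y hx hy => simp only [map_add, qmul2_add_right, hx, hy]

lemma qmul2_prependLeft_prependLeft (I J : CWord n) (x y : QSymC k n ⊗[k] QSymC k n) :
    qmul2 k n (prependLeft k I x) (prependLeft k J y) =
      prependLeft k I (qmul2 k n x (prependLeft k J y)) +
      prependLeft k J (qmul2 k n (prependLeft k I x) y) +
      prependLeft k (wordConcat I J) (qmul2 k n x y) := by
  induction x with
  | zero => simp
  | add x x' hx hx' =>
    simp only [map_add, qmul2_add_left, hx, hx']
    abel
  | tmul a b =>
    induction y with
    | zero => simp
    | add y y' hy hy' =>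
      simp only [map_add, qmul2_add_right, hy, hy']
      abel
    | tmul c d => simp [qmulL_prependL_prependL, TensorProduct.add_tmul]

lemma qdelta_single (I : Multiseq n) :
    qdelta k n (Finsupp.single I 1) = ∑ j ∈ Finset.range (I.length + 1),
      Finsupp.single (I.take j) (1 : k) ⊗ₜ[k] Finsupp.single (I.drop j) (1 : k) := by
  simp [qdelta]

lemma qdelta_single_nil :
    qdelta k n (Finsupp.single [] 1) = Finsupp.single [] 1 ⊗ₜ[k] Finsupp.single [] 1 := by
  simp [qdelta_single]

/-- The cocycle property of prepending a block. -/
lemma qdelta_prependL (I : CWord n) (x : QSymC k n) :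
    qdelta k n (prependL k I x) =
      Finsupp.single [] 1 ⊗ₜ[k] prependL k I x + prependLeft k I (qdelta k n x) := by
  suffices h : qdelta k n ∘ₗ prependL k I =
      TensorProduct.mk k _ _ (Finsupp.single [] 1) ∘ₗ prependL k I +
        prependLeft k I ∘ₗ qdelta k n from LinearMap.congr_fun h x
  apply Finsupp.lhom_ext'
  intro L
  apply LinearMap.ext_ring
  simp [qdelta_single, Finset.sum_range_succ' _ (List.length L + 1)]
  exact add_comm _ _

lemma qdelta_qsBasis (I J : Multiseq n) :
    qdelta k n (qsBasis k n I J) =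
      qmul2 k n (qdelta k n (Finsupp.single I 1)) (qdelta k n (Finsupp.single J 1)) := by
  induction I generalizing J with
  | nil => rw [qdelta_single_nil, qmul2_one_left, qsBasis]
  | cons I Is ihI =>
    induction J with
    | nil => rw [qdelta_single_nil, qmul2_one_right, qsBasis_nil_right]
    | cons J Js ihJ =>
      have hrec := qmulL_prependL_prependL I J
        (Finsupp.single Is (1 : k)) (Finsupp.single Js 1)
      simp only [prependL_single, qmulL_single_single] at hrec
      have hI := qdelta_prependL I (Finsupp.single Is (1 : k))
      have hJ := qdelta_prependL J (Finsupp.single Js (1 : k))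
      rw [prependL_single] at hI hJ
      conv_lhs => rw [hrec]
      simp only [map_add, qdelta_prependL, ihI, ihJ]
      rw [hI, hJ]
      simp only [qmul2_add_left, qmul2_add_right, qmul2_prependLeft_prependLeft,
        qmul2_prependLeft_one_tmul, qmul2_one_tmul_prependLeft, qmul2_tmul,
        qmulL_single_single, qsBasis_nil_right, hrec, map_add, TensorProduct.tmul_add]
      abel

end QuasiShuffle

/-- The deconcatenation coproduct is multiplicative with respect to the
quasi-shuffle product: this is the bialgebra compatibility of `QSym_n`. -/
theorem qdelta_multiplicative (k : Type*) [Field k] [CharZero k]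
    (n : ℕ) (hn : 1 ≤ n) (u v : QSymC k n) :
    qdelta k n (qmulL k n u v) = qmul2 k n (qdelta k n u) (qdelta k n v) := by
  induction u using Finsupp.induction_linear with
  | zero => simp
  | add u u' hu hu' => simp only [map_add, LinearMap.add_apply, qmul2_add_left, hu, hu']
  | single I a =>
    induction v using Finsupp.induction_linear with
    | zero => simp
    | add v v' hv hv' => simp only [map_add, qmul2_add_right, hv, hv']
    | single J b =>
      rw [← mul_one a, ← mul_one b, ← smul_eq_mul, ← smul_eq_mul, ← Finsupp.smul_single,
        ← Finsupp.smul_single]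
      simp only [map_smul, LinearMap.smul_apply, qmul2_smul_left, qmul2_smul_right,
        qmulL_single_single, qdelta_qsBasis]

end
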